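/- arXiv:1910.09837 — 3 statements merged into one kernel-verified Lean document; each statement's English description precedes it below -/
import Mathlib

section
/- Let 0 < a ≤ 1/2 and define G_a(u) := Σ_{n∈ℤ} ( exp(−π u² (n+a)²) + exp(−π u² n² + 2πina) ) for u > 0. Then for every complex s with 0 < Re(s) < 1 one has π^{−s/2} Γ(s/2) Q(s,a) = ∫_0^∞ u^{−s} ( G_a(u) − 1 − 1/u ) du, where the integral converges. -/
open Complex MeasureTheory

/-- The Hurwitz zeta function `ζ(s, a)`. -/
noncomputable def hzeta (a : ℝ) (s : ℂ) : ℂ := HurwitzZeta.hurwitzZeta (a : UnitAddCircle) s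

/-- The periodic (exponential) zeta function `Li(s, a)`. -/
noncomputable def pzeta (a : ℝ) (s : ℂ) : ℂ := HurwitzZeta.expZeta (a : UnitAddCircle) s

/-- The quadrilateral zeta function `Q(s, a)`, defined by
`2Q(s,a) = ζ(s,a) + ζ(s,1−a) + Li(s,a) + Li(s,1−a)`. -/
noncomputable def Qzeta (s : ℂ) (a : ℝ) : ℂ :=
  (hzeta a s + hzeta (1 - a) s + pzeta a s + pzeta (1 - a) s) / 2

/-- The theta-type series `G_a(u)` (for a real argument `u`). -/
noncomputable def Gfun (a : ℝ) (u : ℝ) : ℂ :=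
  ∑' n : ℤ, (Complex.exp (-Real.pi * u ^ 2 * (n + a) ^ 2) +
    Complex.exp (-Real.pi * u ^ 2 * n ^ 2 + 2 * Real.pi * Complex.I * n * a))

open Set Filter in
lemma hasMellin_strip (P : WeakFEPair ℂ) {z : ℂ} (h0 : 0 < z.re) (h1 : z.re < P.k) :
    HasMellin (fun x : ℝ => P.f x - P.f₀ - P.ε * ((x ^ (-P.k) : ℝ) : ℂ) * P.g₀) z (P.Λ z) := by
  have hA : HasMellin P.f_modif z (P.Λ₀ z) :=
    ⟨(P.isStrongFEPair_toStrongFEPair.hasMellin z).1, rfl⟩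
  have hB := hasMellin_one_Ioc h0
  have hC : HasMellin (indicator (Ioi 1) (fun t => (t : ℂ) ^ (-(P.k : ℂ)) : ℝ → ℂ)) z
      (1 / (P.k - z)) := by
    have hre : (z - 1 + -(P.k : ℂ)).re < -1 := by simp; linarith
    have hne : (P.k : ℂ) - z ≠ 0 := by
      intro h
      have := congrArg Complex.re h
      simp at this; linarith
    have hne2 : z - 1 + -(P.k : ℂ) + 1 ≠ 0 := by
      intro h; apply hne; linear_combination -h
    have hsub : Ioi (0 : ℝ) ∩ Ioi 1 = Ioi 1 := by
      ext x; simp only [mem_inter_iff, mem_Ioi]; constructor <;> [exact fun h => h.2; exact fun h => ⟨by linarith, h⟩]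
    have hcongr : EqOn (fun t : ℝ => (t : ℂ) ^ (z - 1 + -(P.k : ℂ)))
        (fun t : ℝ => (t : ℂ) ^ (z - 1) • (t : ℂ) ^ (-(P.k : ℂ))) (Ioi 1) := by
      intro t ht
      have : (t : ℂ) ≠ 0 := ofReal_ne_zero.mpr (by have : (1:ℝ) < t := ht; linarith)
      simp only [smul_eq_mul]
      rw [cpow_add _ _ this]
    have hint := integrableOn_Ioi_cpow_of_lt hre one_pos
    have hval := integral_Ioi_cpow_of_lt hre one_pos
    rw [setIntegral_congr_fun measurableSet_Ioi hcongr] at hval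
    rw [integrableOn_congr_fun hcongr measurableSet_Ioi] at hint
    simp_rw [HasMellin, mellin, MellinConvergent, ← indicator_smul]
    constructor
    · rw [IntegrableOn, integrable_indicator_iff measurableSet_Ioi, IntegrableOn,
        Measure.restrict_restrict measurableSet_Ioi, inter_comm, hsub]
      exact hint
    · rw [setIntegral_indicator measurableSet_Ioi, hsub, hval]
      simp only [ofReal_one, one_cpow]
      rw [div_eq_div_iff hne2 hne]; ring
  have hB' := hasMellin_const_smul hB.1 P.f₀
  have hC' := hasMellin_const_smul hC.1 (P.ε * P.g₀)
  have hAB := hasMellin_sub hA.1 hB'.1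
  have hABC := hasMellin_sub hAB.1 hC'.1
  have hae : (fun t : ℝ => (t : ℂ) ^ (z - 1) •
      (P.f_modif t - P.f₀ • indicator (Ioc 0 1) (fun _ => 1 : ℝ → ℂ) t -
        (P.ε * P.g₀) • indicator (Ioi 1) (fun t => (t : ℂ) ^ (-(P.k : ℂ)) : ℝ → ℂ) t))
      =ᵐ[volume.restrict (Ioi 0)]
      (fun x : ℝ => (x : ℂ) ^ (z - 1) •
        (P.f x - P.f₀ - P.ε * ((x ^ (-P.k) : ℝ) : ℂ) * P.g₀)) := by
    have hn : ∀ᵐ x : ℝ ∂(volume.restrict (Ioi (0 : ℝ))), x ≠ 1 :=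
      ae_restrict_of_ae (Measure.ae_ne volume 1)
    filter_upwards [ae_restrict_mem measurableSet_Ioi, hn] with x hx hx1
    have hx0 : 0 < x := hx
    congr 1
    rw [ofReal_cpow hx0.le]
    rcases lt_or_gt_of_ne hx1 with h | h
    · simp [WeakFEPair.f_modif, h, h.le, hx0, not_lt.mpr h.le, ofReal_cpow hx0.le]
      ring
    · simp [WeakFEPair.f_modif, h, h.le, hx0, not_lt.mpr h.le, not_le.mpr h]
      ring
  refine ⟨hABC.1.congr hae, ?_⟩
  refine (integral_congr_ae hae).symm.trans (hABC.2.trans ?_)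
  rw [hAB.2, hB'.2, hC'.2, hA.2, hB.2, hC.2, WeakFEPair.Λ]
  simp only [smul_eq_mul]
  ring

lemma Gfun_eq (a u : ℝ) (hu : 0 < u) :
    Gfun a u = (HurwitzZeta.evenKernel a (u ^ 2) : ℂ) + (HurwitzZeta.cosKernel a (u ^ 2) : ℂ) := by
  have h1 := hasSum_ofReal.mpr (HurwitzZeta.hasSum_int_evenKernel a (pow_pos hu 2))
  have h2 := HurwitzZeta.hasSum_int_cosKernel a (pow_pos hu 2)
  rw [Gfun, ← (h1.add h2).tsum_eq]
  refine tsum_congr fun n => ?_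
  push_cast
  rw [← Complex.exp_add]
  congr 2 <;> ring

/-- Integral representation: for `0 < Re(s) < 1`,
`π^{-s/2} Γ(s/2) Q(s,a) = ∫_0^∞ u^{-s} (G_a(u) − 1 − 1/u) du`, and the integral converges. -/
theorem quadrilateral_integral_representation (a : ℝ) (ha : 0 < a) (ha' : a ≤ 1 / 2)
    (s : ℂ) (hs0 : 0 < s.re) (hs1 : s.re < 1) :
    IntegrableOn (fun u : ℝ => (u : ℂ) ^ (-s) * (Gfun a u - 1 - 1 / (u : ℂ))) (Set.Ioi 0) ∧
    (Real.pi : ℂ) ^ (-s / 2) * Complex.Gamma (s / 2) * Qzeta s a =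
      ∫ u in Set.Ioi (0 : ℝ), (u : ℂ) ^ (-s) * (Gfun a u - 1 - 1 / (u : ℂ)) := by
  have hane : (a : UnitAddCircle) ≠ 0 := by
    intro h
    rw [AddCircle.coe_eq_zero_iff] at h
    obtain ⟨n, hn⟩ := h
    simp at hn
    have h1 : (0 : ℝ) < n := by linarith
    have h2 : (n : ℝ) < 1 := by linarith
    have h3 : 0 < n := by exact_mod_cast h1
    have h4 : n < 1 := by exact_mod_cast h2
    omega
  have hneg : ((1 - a : ℝ) : UnitAddCircle) = -(a : UnitAddCircle) := by
    rw [AddCircle.coe_sub, AddCircle.coe_period, zero_sub]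
  set P := HurwitzZeta.hurwitzEvenFEPair (a : UnitAddCircle) with hP
  have hz0 : 0 < ((1 - s) / 2).re := by simp; linarith
  have hz1 : ((1 - s) / 2).re < 1 / 2 := by simp; linarith
  have hM1 := hasMellin_strip P hz0 hz1
  have hM2 := hasMellin_strip P.symm hz0 hz1
  have hM := hasMellin_add hM1.1 hM2.1
  rw [hM1.2, hM2.2] at hM
  have hcast : (1 - s) / 2 = (1 - s) / ((2 : ℝ) : ℂ) := by simp
  have hconv := hM.1
  have hval := hM.2
  rw [hcast] at hconv hval
  have hconv2 := (MellinConvergent.comp_rpow (two_ne_zero (α := ℝ))).mpr hconv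
  have hval2 := mellin_comp_rpow (fun t => P.f t - P.f₀ - P.ε * ((t ^ (-P.k) : ℝ) : ℂ) * P.g₀ +
    (P.symm.f t - P.symm.f₀ - P.symm.ε * ((t ^ (-P.symm.k) : ℝ) : ℂ) * P.symm.g₀)) (1 - s) 2
  rw [hval] at hval2
  have hcongr : Set.EqOn (fun u : ℝ => (u : ℂ) ^ (1 - s - 1) •
     (P.f (u ^ (2 : ℝ)) - P.f₀ - P.ε * (((u ^ (2 : ℝ)) ^ (-P.k) : ℝ) : ℂ) * P.g₀ +
    (P.symm.f (u ^ (2 : ℝ)) - P.symm.f₀ -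
      P.symm.ε * (((u ^ (2 : ℝ)) ^ (-P.symm.k) : ℝ) : ℂ) * P.symm.g₀)))
      (fun u : ℝ => (u : ℂ) ^ (-s) * (Gfun a u - 1 - 1 / (u : ℂ))) (Set.Ioi 0) := by
    intro u hu
    have hu0 : 0 < u := hu
    have e1 : (u ^ 2) ^ (-(1 / 2 : ℝ)) = u⁻¹ := by
      rw [← Real.rpow_two, ← Real.rpow_mul hu0.le]; norm_num [Real.rpow_neg_one]
    have hk : P.k = 1 / 2 := rfl
    have hf0 : P.f₀ = 0 := by simp [hP, HurwitzZeta.hurwitzEvenFEPair, hane]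
    have hg0 : P.g₀ = 1 := rfl
    have he : P.ε = 1 := rfl
    have hf : ∀ t, P.f t = (HurwitzZeta.evenKernel a t : ℂ) := fun t => rfl
    have hg : ∀ t, P.symm.f t = (HurwitzZeta.cosKernel a t : ℂ) := fun t => rfl
    have hsf0 : P.symm.f₀ = 1 := rfl
    have hsg0 : P.symm.g₀ = 0 := hf0
    simp only [hf, hg, hf0, hg0, he, hsf0, hsg0, hk, e1, Gfun_eq a u hu0, smul_eq_mul,
      Real.rpow_two]
    rw [show 1 - s - 1 = -s by ring]
    push_cast
    ring
  refine ⟨(integrableOn_congr_fun hcongr measurableSet_Ioi).mp hconv2, ?_⟩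
  unfold mellin at hval2
  rw [setIntegral_congr_fun measurableSet_Ioi hcongr] at hval2
  rw [hval2]
  have hs : s ≠ 0 := by rintro rfl; simp at hs0
  have hG := Gammaℝ_ne_zero_of_re_pos hs0
  have hQ : Qzeta s a = HurwitzZeta.hurwitzZetaEven a s + HurwitzZeta.cosZeta a s := by
    rw [Qzeta, hzeta, hzeta, pzeta, pzeta, hneg, HurwitzZeta.hurwitzZetaEven_eq,
      HurwitzZeta.cosZeta_eq]
    ring
  have hE := (HurwitzZeta.completedCosZeta_one_sub (a : UnitAddCircle) s).symm
  have hC := (HurwitzZeta.completedHurwitzZetaEven_one_sub (a : UnitAddCircle) s).symm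
  rw [hQ, HurwitzZeta.hurwitzZetaEven_def_of_ne_or_ne (Or.inr hs), HurwitzZeta.cosZeta,
    Function.update_of_ne hs, ← Gammaℝ_def, hE, hC, HurwitzZeta.completedCosZeta,
    HurwitzZeta.completedHurwitzZetaEven, ← hcast]
  rw [← hP]
  field_simp
  simp
  ring
end

section
/- Let q and r be relatively prime integers with 0 < r < q. Then for every complex s with s ≠ 1, ζ(s, r/q) = (q^s / φ(q)) · Σ_{χ mod q} conj(χ)(r) · L(s, χ), where the sum is over all Dirichlet characters χ modulo q, L(s,χ) denotes the (analytically continued) Dirichlet L-function, and φ is Euler's totient function. -/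
open Complex MeasureTheory

/-- For `0 < r < q` coprime, `ζ(s, r/q) = (q^s / φ(q)) Σ_{χ mod q} conj(χ(r)) L(s, χ)`. -/
theorem hurwitz_eq_sum_LFunction (q r : ℕ) [NeZero q] (hr : 0 < r) (hrq : r < q)
    (hcop : Nat.Coprime r q) (s : ℂ) (hs : s ≠ 1) :
    hzeta ((r : ℝ) / q) s =
      (q : ℂ) ^ s / (Nat.totient q : ℂ) *
        ∑ χ : DirichletCharacter ℂ q,
          (starRingEnd ℂ) (χ (r : ZMod q)) * DirichletCharacter.LFunction χ s := by
  have hu : IsUnit (r : ZMod q) := (ZMod.isUnit_iff_coprime r q).mpr hcop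
  have hconj : ∀ χ : DirichletCharacter ℂ q,
      (starRingEnd ℂ) (χ (r : ZMod q)) = χ (r : ZMod q)⁻¹ := by
    intro χ
    have h1 : (starRingEnd ℂ) (χ (r : ZMod q)) = χ⁻¹ (r : ZMod q) := MulChar.star_apply' χ _
    have h2 : χ⁻¹ (r : ZMod q) * χ (r : ZMod q) = 1 := by
      rw [← MulChar.mul_apply, inv_mul_cancel, MulChar.one_apply hu]
    have h3 : χ (r : ZMod q)⁻¹ * χ (r : ZMod q) = 1 := by
      rw [← map_mul, ZMod.inv_mul_of_unit _ hu, map_one]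
    rw [h1]
    exact mul_right_cancel₀ (right_ne_zero_of_mul_eq_one h2) (h2.trans h3.symm)
  have hφ : (Nat.totient q : ℂ) ≠ 0 := by
    exact_mod_cast (Nat.totient_pos.mpr (NeZero.pos q)).ne'
  have hq : (q : ℂ) ≠ 0 := NeZero.ne _
  have hqs : (q : ℂ) ^ s * (q : ℂ) ^ (-s) = 1 := by
    rw [← Complex.cpow_add _ _ hq, add_neg_cancel, Complex.cpow_zero]
  have key : ∑ χ : DirichletCharacter ℂ q,
      (starRingEnd ℂ) (χ (r : ZMod q)) * DirichletCharacter.LFunction χ s =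
      (q : ℂ) ^ (-s) * (Nat.totient q * hzeta ((r : ℝ) / q) s) := by
    have : ∀ χ : DirichletCharacter ℂ q,
        (starRingEnd ℂ) (χ (r : ZMod q)) * DirichletCharacter.LFunction χ s =
        ∑ j : ZMod q, (q : ℂ) ^ (-s) * (χ (r : ZMod q)⁻¹ * χ j *
          HurwitzZeta.hurwitzZeta (ZMod.toAddCircle j) s) := by
      intro χ
      rw [hconj, DirichletCharacter.LFunction, ZMod.LFunction, Finset.mul_sum, Finset.mul_sum]
      exact Finset.sum_congr rfl fun j _ => by ring
    rw [Finset.sum_congr rfl fun χ _ => this χ, Finset.sum_comm]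
    simp_rw [← Finset.mul_sum, ← Finset.sum_mul,
      DirichletCharacter.sum_char_inv_mul_char_eq ℂ hu]
    simp [hzeta, ZMod.toAddCircle_natCast]
  rw [key]
  calc _ = ((q : ℂ) ^ s * (q : ℂ) ^ (-s)) * hzeta ((r : ℝ) / q) s := by rw [hqs, one_mul]
    _ = _ := by field_simp
end

section
/- Let 0 < a ≤ 1/2. For every complex s with Re(s) > 1, 2 ∫_0^∞ u^{s−1} Σ_{n∈ℤ} exp(−π u² (n+a)²) du = π^{−s/2} Γ(s/2) ( ζ(s,a) + ζ(s,1−a) ). -/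
open Complex MeasureTheory

/-- Mellin-transform identity for the even theta series: for `Re(s) > 1`,
`2 ∫_0^∞ u^{s−1} Σ_{n∈ℤ} exp(−πu²(n+a)²) du = π^{−s/2} Γ(s/2) (ζ(s,a) + ζ(s,1−a))`. -/
theorem mellin_theta_even (a : ℝ) (ha : 0 < a) (ha' : a ≤ 1 / 2) (s : ℂ) (hs : 1 < s.re) :
    2 * ∫ u in Set.Ioi (0 : ℝ),
        (u : ℂ) ^ (s - 1) * ∑' n : ℤ, Complex.exp (-Real.pi * u ^ 2 * (n + a) ^ 2) =
      (Real.pi : ℂ) ^ (-s / 2) * Complex.Gamma (s / 2) * (hzeta a s + hzeta (1 - a) s) := by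
  have hne : ∀ n : ℤ, (n : ℝ) + a ≠ 0 := by
    intro n h
    have h1 : (n : ℝ) < 0 := by linarith
    have h2 : (-1 : ℝ) < n := by linarith
    have h3 : n < 0 := by exact_mod_cast h1
    have h4 : -1 < n := by exact_mod_cast h2
    omega
  have hz : hzeta a s + hzeta (1 - a) s = 2 * HurwitzZeta.hurwitzZetaEven (a : UnitAddCircle) s := by
    have : ((1 - a : ℝ) : UnitAddCircle) = -(a : UnitAddCircle) := by
      rw [AddCircle.coe_sub, AddCircle.coe_period, zero_sub]
    simp only [hzeta, this, HurwitzZeta.hurwitzZeta, HurwitzZeta.hurwitzZetaEven_neg,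
      HurwitzZeta.hurwitzZetaOdd_neg]
    ring
  have hF : ∀ t ∈ Set.Ioi (0 : ℝ), HasSum (fun n : ℤ ↦ if (n : ℝ) + a = 0 then 0
      else (1 : ℂ) * Real.exp (-Real.pi * ((n : ℝ) + a) ^ 2 * t))
      ((HurwitzZeta.evenKernel a t : ℝ) : ℂ) := by
    intro t ht
    simp only [hne, if_false, one_mul]
    exact Complex.hasSum_ofReal.mpr (HurwitzZeta.hasSum_int_evenKernel a ht)
  have hsum : Summable fun n : ℤ ↦ ‖(1 : ℂ)‖ / |(n : ℝ) + a| ^ s.re := by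
    simpa using (Real.summable_one_div_int_add_rpow a s.re).mpr hs
  have hm := hasSum_mellin_pi_mul_sq (zero_lt_one.trans hs) hF hsum
  have he := ((HurwitzZeta.hasSum_int_hurwitzZetaEven a hs).mul_left (2 * Gammaℝ s))
  have hmain : mellin (fun t ↦ ((HurwitzZeta.evenKernel a t : ℝ) : ℂ)) (s / 2)
      = 2 * Gammaℝ s * HurwitzZeta.hurwitzZetaEven a s := by
    refine hm.unique (he.congr_fun fun n ↦ ?_)
    push_cast
    ring
  have hc := mellin_comp_rpow (fun t ↦ ((HurwitzZeta.evenKernel a t : ℝ) : ℂ)) s (2 : ℝ)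
  have hint : (∫ u in Set.Ioi (0 : ℝ),
        (u : ℂ) ^ (s - 1) * ∑' n : ℤ, Complex.exp (-Real.pi * u ^ 2 * (n + a) ^ 2)) =
      mellin (fun t ↦ ((HurwitzZeta.evenKernel a (t ^ (2 : ℝ)) : ℝ) : ℂ)) s := by
    refine setIntegral_congr_fun measurableSet_Ioi fun u hu ↦ ?_
    have hu2 : 0 < u ^ (2 : ℝ) := Real.rpow_pos_of_pos hu _
    simp only [smul_eq_mul]
    rw [← (Complex.hasSum_ofReal.mpr (HurwitzZeta.hasSum_int_evenKernel a hu2)).tsum_eq]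
    congr 1
    refine tsum_congr fun n ↦ ?_
    rw [Real.rpow_two]
    push_cast
    congr 1
    ring
  rw [hint, hc, hz]
  simp only [ofReal_ofNat]
  rw [hmain, Gammaℝ_def]
  simp [Complex.real_smul]
  ring
end
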